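/- Order the generators y_{i,j} (1 ≤ i < j ≤ n) of E_n^! by declaring y_{i,j} < y_{k,l} if j < l, or if j = l and i < k; that is, y_{1,2} < y_{1,3} < y_{2,3} < y_{1,4} < y_{2,4} < y_{3,4} < ⋯ < y_{n-1,n}. Then every element of E_n^! is a k-linear combination of the ordered monomials y_{1,2}^{r_{1,2}} y_{1,3}^{r_{1,3}} y_{2,3}^{r_{2,3}} y_{1,4}^{r_{1,4}} ⋯ y_{n-2,n}^{r_{n-2,n}} y_{n-1,n}^{r_{n-1,n}} with all exponents r_{i,j} ≥ 0. Equivalently, these ordered monomials span E_n^! as a k-vector space. -/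

import Mathlib

/- The quadratic dual Fomin–Kirillov algebra `E_n^!` over an algebraically
closed field `k` of characteristic zero, presented as a quotient of the free
algebra on generators `y_{i,j}` (for `1 ≤ i < j ≤ n`, realized here with
`0`-based indexing by the subtype of pairs `(i,j) : Fin n × Fin n` with `i < j`),
with the convention `y_{j,i} = -y_{i,j}`. -/

noncomputable section

variable (k : Type) [Field k] [IsAlgClosed k] [CharZero k]

/-- Index set for the generators: pairs `(i,j)` with `i < j`. -/
abbrev FKIdx (n : ℕ) := {p : Fin n × Fin n // p.1 < p.2}

/-- The element `y_{i,j}` of the free algebra, with the convention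
`y_{j,i} = -y_{i,j}` (and `y_{i,i} = 0`, which is never used). -/
def Ygen (n : ℕ) (i j : Fin n) : FreeAlgebra k (FKIdx n) :=
  if h : i < j then FreeAlgebra.ι k ⟨(i, j), h⟩
  else if h' : j < i then - FreeAlgebra.ι k ⟨(j, i), h'⟩
  else 0

/-- The defining relations of `E_n^!`. -/
inductive FKRel (n : ℕ) : FreeAlgebra k (FKIdx n) → FreeAlgebra k (FKIdx n) → Prop
  | triple (i j l : Fin n) (hij : i ≠ j) (hjl : j ≠ l) (hil : i ≠ l) :
      FKRel n (Ygen k n i j * Ygen k n j l + Ygen k n j l * Ygen k n i l) 0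
  | disj (i j s t : Fin n) (hij : i < j) (hst : s < t)
      (h1 : i ≠ s) (h2 : i ≠ t) (h3 : j ≠ s) (h4 : j ≠ t) :
      FKRel n (Ygen k n i j * Ygen k n s t + Ygen k n s t * Ygen k n i j) 0

/-- The quadratic dual Fomin–Kirillov algebra `E_n^!`. -/
abbrev FKDual (n : ℕ) := RingQuot (FKRel k n)

/-- The generator `y_{i,j}` of `E_n^!`. -/
def yy (n : ℕ) (i j : Fin n) : FKDual k n :=
  RingQuot.mkAlgHom k (FKRel k n) (Ygen k n i j)

/-- The list of ordered index pairs `(i,j)` with `i < j`, listed in the order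
`y_{1,2} < y_{1,3} < y_{2,3} < y_{1,4} < y_{2,4} < y_{3,4} < ⋯ < y_{n-1,n}`,
i.e. ordered by `j` first and then by `i`. -/
def pairList (n : ℕ) : List (Fin n × Fin n) :=
  (List.finRange n).flatMap fun j =>
    ((List.finRange n).filter fun i => decide (i < j)).map fun i => (i, j)

set_option linter.unusedSectionVars false

theorem ring_aux1 {R : Type*} [Ring R] (a b c d : R) (h : -a * b = -(c * -d)) :
    a * b = -(c * d) := by
  rw [neg_mul, mul_neg, neg_neg] at h
  rw [← h, neg_neg]

theorem ring_aux2 {R : Type*} [Ring R] (a b c d : R) (h : -a * -b = -(-c * -d)) :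
    a * b = -(c * d) := by
  simpa using h

theorem ring_aux3 {R : Type*} [Ring R] (p x y u v s : R) (h : x * y = -(u * v)) :
    p * (x * (y * s)) = -(p * (u * (v * s))) := by
  rw [← mul_assoc x, h, neg_mul, mul_neg, mul_assoc]

/-- Numerical key realizing the order on generators. -/
def fkKey (n : ℕ) (p : Fin n × Fin n) : ℕ := p.2.1 * n + p.1.1

theorem fkKey_lt_iff (n : ℕ) (p q : Fin n × Fin n) :
    fkKey n q < fkKey n p ↔ (q.2 < p.2 ∨ (q.2 = p.2 ∧ q.1 < p.1)) := by
  obtain ⟨⟨i, hi⟩, ⟨j, hj⟩⟩ := p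
  obtain ⟨⟨s, hs⟩, ⟨t, ht⟩⟩ := q
  simp only [fkKey, Fin.mk_lt_mk, Fin.mk.injEq]
  rcases lt_trichotomy t j with h | h | h
  · have : (t + 1) * n ≤ j * n := Nat.mul_le_mul_right n h
    have h2 : (t + 1) * n = t * n + n := by ring
    constructor
    · intro _; exact Or.inl h
    · intro _; omega
  · subst h
    constructor
    · intro _; right; constructor <;> omega
    · intro _; omega
  · have : (j + 1) * n ≤ t * n := Nat.mul_le_mul_right n h
    have h2 : (j + 1) * n = j * n + n := by ring
    constructor
    · intro _; omega
    · intro _; omega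

theorem fkKey_bound (n : ℕ) (p : Fin n × Fin n) : fkKey n p < n * n := by
  obtain ⟨⟨i, hi⟩, ⟨j, hj⟩⟩ := p
  simp only [fkKey]
  have : (j + 1) * n ≤ n * n := Nat.mul_le_mul_right n hj
  have h2 : (j + 1) * n = j * n + n := by ring
  omega

theorem yy_triple (n : ℕ) (i j l : Fin n) (hij : i ≠ j) (hjl : j ≠ l) (hil : i ≠ l) :
    yy k n i j * yy k n j l = - (yy k n j l * yy k n i l) := by
  have := RingQuot.mkAlgHom_rel k (FKRel.triple (k := k) i j l hij hjl hil)
  simp only [map_add, map_mul, map_zero] at this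
  exact eq_neg_of_add_eq_zero_left this

theorem yy_disj (n : ℕ) (i j s t : Fin n) (hij : i < j) (hst : s < t)
    (h1 : i ≠ s) (h2 : i ≠ t) (h3 : j ≠ s) (h4 : j ≠ t) :
    yy k n i j * yy k n s t = - (yy k n s t * yy k n i j) := by
  have := RingQuot.mkAlgHom_rel k (FKRel.disj (k := k) i j s t hij hst h1 h2 h3 h4)
  simp only [map_add, map_mul, map_zero] at this
  exact eq_neg_of_add_eq_zero_left this

theorem yy_anti (n : ℕ) (i j : Fin n) (h : i < j) : yy k n j i = - yy k n i j := by
  simp [yy, Ygen, h, h.not_gt]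

/-- The generator attached to a pair. -/
def yp (n : ℕ) (p : FKIdx n) : FKDual k n := yy k n p.1.1 p.1.2

/-- An inverted product of two generators is minus a product with smaller first factor. -/
theorem fk_rewrite (n : ℕ) (p q : FKIdx n) (h : fkKey n q.1 < fkKey n p.1) :
    ∃ u v : FKIdx n, fkKey n u.1 < fkKey n p.1 ∧
      yp k n p * yp k n q = - (yp k n u * yp k n v) := by
  rw [fkKey_lt_iff] at h
  obtain ⟨⟨i, j⟩, hij⟩ := p
  obtain ⟨⟨s, t⟩, hst⟩ := q
  simp only at hij hst h
  simp only [yp, fkKey_lt_iff]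
  rcases h with h | ⟨rfl, h⟩
  · by_cases his : i = s
    · subst his
      refine ⟨⟨(i, t), hst⟩, ⟨(t, j), h⟩, Or.inl h, ?_⟩
      have := yy_triple k n j i t hij.ne' hst.ne h.ne'
      rw [yy_anti k n i j hij, yy_anti k n t j h] at this
      exact ring_aux1 _ _ _ _ this
    · by_cases hit : i = t
      · subst hit
        refine ⟨⟨(s, i), hst⟩, ⟨(s, j), hst.trans hij⟩, Or.inl h, ?_⟩
        have := yy_triple k n j i s hij.ne' hst.ne' (hst.trans hij).ne'
        rw [yy_anti k n i j hij, yy_anti k n s i hst, yy_anti k n s j (hst.trans hij)] at this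
        exact ring_aux2 _ _ _ _ this
      · exact ⟨⟨(s, t), hst⟩, ⟨(i, j), hij⟩, Or.inl h,
          yy_disj k n i j s t hij hst his hit (hst.trans h).ne' h.ne'⟩
  · refine ⟨⟨(s, i), h⟩, ⟨(i, t), hij⟩, Or.inl hij, ?_⟩
    rw [yy_triple k n s i t h.ne hij.ne hst.ne, neg_neg]

/-- Base-`n*n` value of a word. -/
def fkVal (n : ℕ) : List (FKIdx n) → ℕ
  | [] => 0
  | a :: l => fkKey n a.1 * (n * n) ^ l.length + fkVal n l

theorem fkVal_lt (n : ℕ) (l : List (FKIdx n)) : fkVal n l < (n * n) ^ l.length := by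
  induction l with
  | nil => simp [fkVal]
  | cons a l ih =>
    have := Nat.mul_le_mul_right ((n * n) ^ l.length) (fkKey_bound n a.1)
    have h2 := Nat.succ_mul (fkKey n a.1) ((n * n) ^ l.length)
    simp only [fkVal, List.length_cons, pow_succ']
    simp only [Nat.succ_eq_add_one] at *
    omega

theorem fkVal_dec (n : ℕ) (w s : List (FKIdx n)) (x y u v : FKIdx n)
    (h : fkKey n u.1 < fkKey n x.1) :
    fkVal n (w ++ u :: v :: s) < fkVal n (w ++ x :: y :: s) := by
  induction w with
  | nil =>
    have h1 := fkVal_lt n (v :: s)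
    have := Nat.mul_le_mul_right ((n * n) ^ (v :: s).length) h
    have h2 := Nat.succ_mul (fkKey n u.1) ((n * n) ^ (v :: s).length)
    rw [List.nil_append, List.nil_append, fkVal, fkVal.eq_2 n x]
    simp only [Nat.succ_eq_add_one, List.length_cons] at *
    omega
  | cons a w ih =>
    simp only [List.cons_append, fkVal, List.length_append, List.length_cons]
    omega

theorem fk_exists_inversion (n : ℕ) (w : List (FKIdx n))
    (h : ¬ w.IsChain (fun a b => fkKey n a.1 ≤ fkKey n b.1)) :
    ∃ p s x y, w = p ++ x :: y :: s ∧ fkKey n y.1 < fkKey n x.1 := by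
  induction w with
  | nil => simp at h
  | cons a w ih =>
    cases w with
    | nil => simp at h
    | cons b w =>
      by_cases hab : fkKey n a.1 ≤ fkKey n b.1
      · rw [List.isChain_cons_cons] at h
        obtain ⟨p, s, x, y, h1, h2⟩ := ih (fun hc => h ⟨hab, hc⟩)
        exact ⟨a :: p, s, x, y, by rw [h1]; rfl, h2⟩
      · exact ⟨[], w, a, b, rfl, not_le.mp hab⟩

theorem sorted_word_prod {α M : Type*} [DecidableEq α] [Monoid M] (f : α → M) (key : α → ℕ)
    (L : List α) (hL : L.Pairwise (fun a b => key a < key b)) (w : List α)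
    (hw : w.Pairwise (fun a b => key a ≤ key b)) (hwL : ∀ x ∈ w, x ∈ L) :
    ∃ r : α → ℕ, (w.map f).prod = (L.map fun p => f p ^ r p).prod := by
  induction L generalizing w with
  | nil =>
    have : w = [] := List.eq_nil_iff_forall_not_mem.mpr (fun x hx => by simpa using hwL x hx)
    subst this
    exact ⟨0, by simp⟩
  | cons a L ihL =>
    rw [List.pairwise_cons] at hL
    have haL : a ∉ L := fun h => lt_irrefl _ (hL.1 a h)
    induction w with
    | nil => exact ⟨0, by simp⟩
    | cons x w ihw =>
      by_cases hxa : x = a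
      · subst hxa
        obtain ⟨r, hr⟩ := ihw (List.pairwise_cons.mp hw).2
          (fun y hy => hwL y (List.mem_cons_of_mem _ hy))
        refine ⟨Function.update r x (r x + 1), ?_⟩
        have : (L.map fun p => f p ^ (Function.update r x (r x + 1)) p)
            = L.map fun p => f p ^ r p := by
          apply List.map_congr_left
          intro p hp
          rw [Function.update_of_ne (by rintro rfl; exact haL hp)]
        rw [List.map_cons, List.prod_cons, hr, List.map_cons, List.prod_cons, List.map_cons,
          List.prod_cons, this, Function.update_self, pow_succ', mul_assoc]
      · have hxL : x ∈ L := by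
          have := hwL x List.mem_cons_self
          simpa [hxa] using this
        obtain ⟨r, hr⟩ := ihL hL.2 (x :: w) hw (by
          intro y hy
          rcases List.mem_cons.mp (hwL y hy) with rfl | h
          · exfalso
            rcases List.mem_cons.mp hy with h | h
            · exact hxa h.symm
            · exact absurd ((List.pairwise_cons.mp hw).1 y h) (not_le.mpr (hL.1 x hxL))
          · exact h)
        refine ⟨Function.update r a 0, ?_⟩
        have : (L.map fun p => f p ^ (Function.update r a 0) p)
            = L.map fun p => f p ^ r p := by
          apply List.map_congr_left
          intro p hp
          rw [Function.update_of_ne (by rintro rfl; exact haL hp)]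
        rw [hr, List.map_cons, List.prod_cons, this, Function.update_self, pow_zero, one_mul]

theorem pairList_pairwise (n : ℕ) :
    (pairList n).Pairwise (fun a b => fkKey n a < fkKey n b) := by
  unfold pairList
  rw [List.pairwise_flatMap]
  constructor
  · intro j _
    rw [List.pairwise_map]
    apply List.Pairwise.filter
    exact (List.pairwise_lt_finRange n).imp (fun h => by
      rw [fkKey_lt_iff]; exact Or.inr ⟨rfl, h⟩)
  · apply (List.pairwise_lt_finRange n).imp
    intro a b hab x hx y hy
    simp only [List.mem_map] at hx hy
    obtain ⟨_, _, rfl⟩ := hx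
    obtain ⟨_, _, rfl⟩ := hy
    rw [fkKey_lt_iff]; exact Or.inl hab

theorem mem_pairList (n : ℕ) (p : FKIdx n) : p.1 ∈ pairList n := by
  obtain ⟨⟨i, j⟩, h⟩ := p
  simpa [pairList] using h

theorem fk_word_mem (n : ℕ) (N : ℕ) : ∀ w : List (FKIdx n), fkVal n w = N →
    (w.map (yp k n)).prod ∈ Submodule.span k
      {m : FKDual k n | ∃ r : Fin n × Fin n → ℕ,
        m = ((pairList n).map fun p => (yy k n p.1 p.2) ^ r p).prod} := by
  induction N using Nat.strong_induction_on with
  | _ N ih =>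
    intro w hN
    by_cases hc : w.IsChain (fun a b => fkKey n a.1 ≤ fkKey n b.1)
    · apply Submodule.subset_span
      have : IsTrans (FKIdx n) (fun a b => fkKey n a.1 ≤ fkKey n b.1) :=
        ⟨fun _ _ _ h1 h2 => le_trans h1 h2⟩
      have hp := List.isChain_iff_pairwise.mp hc
      obtain ⟨r, hr⟩ := sorted_word_prod (fun p : Fin n × Fin n => yy k n p.1 p.2) (fkKey n)
        (pairList n) (pairList_pairwise n) (w.map Subtype.val) (List.pairwise_map.mpr hp)
        (by
          intro x hx
          obtain ⟨p, _, rfl⟩ := List.mem_map.mp hx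
          exact mem_pairList n p)
      refine ⟨r, ?_⟩
      rw [← hr, List.map_map]
      rfl
    · obtain ⟨p, s, x, y, rfl, hxy⟩ := fk_exists_inversion n w hc
      obtain ⟨u, v, hu, huv⟩ := fk_rewrite k n x y hxy
      have hlt := fkVal_dec n p s x y u v hu
      have hm := ih _ (hN ▸ hlt) _ rfl
      have : ((p ++ x :: y :: s).map (yp k n)).prod
          = - ((p ++ u :: v :: s).map (yp k n)).prod := by
        simp only [List.map_append, List.map_cons, List.prod_append, List.prod_cons]
        exact ring_aux3 _ _ _ _ _ _ huv
      rw [this]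
      exact Submodule.neg_mem _ hm

theorem fk_words_span (n : ℕ) (x : FKDual k n) : x ∈ Submodule.span k
    (Set.range fun w : List (FKIdx n) => (w.map (yp k n)).prod) := by
  obtain ⟨a, rfl⟩ := RingQuot.mkAlgHom_surjective k (FKRel k n) x
  induction a using FreeAlgebra.induction with
  | grade0 r =>
    rw [AlgHom.commutes, Algebra.algebraMap_eq_smul_one]
    exact Submodule.smul_mem _ _ (Submodule.subset_span ⟨[], rfl⟩)
  | grade1 p =>
    apply Submodule.subset_span
    refine ⟨[p], ?_⟩
    obtain ⟨⟨i, j⟩, h⟩ := p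
    have h' : i < j := h
    simp [yp, yy, Ygen, h']
  | mul a b ha hb =>
    rw [map_mul]
    have := Submodule.mul_mem_mul ha hb
    rw [Submodule.span_mul_span] at this
    refine Submodule.span_mono ?_ this
    rintro _ ⟨_, ⟨w, rfl⟩, _, ⟨w', rfl⟩, rfl⟩
    exact ⟨w ++ w', by simp⟩
  | add a b ha hb =>
    rw [map_add]
    exact Submodule.add_mem _ ha hb

/-- every element of `E_n^!` is a `k`-linear combination of the
ordered monomials `y_{1,2}^{r_{1,2}} y_{1,3}^{r_{1,3}} ⋯ y_{n-1,n}^{r_{n-1,n}}`,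
the factors appearing in the order described above. -/
theorem FKDual_spanned_by_ordered_monomials (n : ℕ) (hn : 2 ≤ n) :
    ∀ x : FKDual k n, x ∈ Submodule.span k
      {m : FKDual k n | ∃ r : Fin n × Fin n → ℕ,
        m = ((pairList n).map fun p => (yy k n p.1 p.2) ^ r p).prod} := by
  intro x
  refine Submodule.span_le.mpr ?_ (fk_words_span k n x)
  rintro _ ⟨w, rfl⟩
  exact fk_word_mem k n _ w rfl

end
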